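/- Lax representation of the first flows of the elliptic sl(N) Gaudin model (Proposition 2.1, part 1): Let z_1,…,z_n ∈ ℂ satisfy z_a − z_c ∉ Γ_τ for all a ≠ c, and fix an index a ∈ {1,…,n}. Let S^c(t) = ∑_{γ∈Γ'_N} S^c_γ(t) T_γ for c = 1,…,n, with differentiable coefficients S^c_γ : ℝ → ℂ. Define L(t,z) = ∑_{c=1}^n ∑_{γ∈Γ'_N} S^c_γ(t) T_γ φ_γ(z − z_c) and M_a(t,z) = ∑_{γ∈Γ'_N} S^a_γ(t) T_γ φ_γ(z − z_a). Then the equations of motion d/dt S^a = −∑_{c≠a} [S^a, φ̂_{z_a−z_c}(S^c)] and d/dt S^b = [S^b, φ̂_{z_b−z_a}(S^a)] for every b ≠ a hold for all t if and only if the Lax equation ∂_t L(t,z) = [L(t,z), M_a(t,z)] holds for all t and all z ∈ ℂ with z − z_c ∉ Γ_τ for every c. -/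

import Mathlib

open scoped BigOperators
open Complex Matrix Finset

noncomputable section

/-- The lattice `Γ_τ = ℤ + τℤ`. -/
def latticeGamma (τ : ℂ) : Set ℂ := {w | ∃ m n : ℤ, w = (m : ℂ) + (n : ℂ) * τ}

/-- The odd theta function `ϑ(z|τ)`. -/
def theta (τ z : ℂ) : ℂ :=
  Complex.exp (2 * (Real.pi : ℂ) * Complex.I * τ / 8) *
    ∑' m : ℤ, (-1 : ℂ) ^ m *
      Complex.exp (2 * (Real.pi : ℂ) * Complex.I * ((m : ℂ) * ((m : ℂ) + 1) * τ / 2 + (m : ℂ) * z))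

/-- The first Eisenstein function `E₁(z) = ϑ'(z)/ϑ(z)`. -/
def E1 (τ z : ℂ) : ℂ := deriv (theta τ) z / theta τ z

/-- The second Eisenstein function `E₂(z) = −E₁'(z)`. -/
def E2 (τ z : ℂ) : ℂ := -deriv (E1 τ) z

/-- The constant `η₁` determined by `E₁(z) = 1/z − 2η₁z + O(z³)` near `z = 0`. -/
def eta1 (τ : ℂ) : ℂ :=
  -(deriv (fun z : ℂ => if z = 0 then 0 else E1 τ z - 1 / z) 0) / 2

/-- The Weierstrass function `℘(z) = E₂(z) − 2η₁`. -/
def wp (τ z : ℂ) : ℂ := E2 τ z - 2 * eta1 τ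

/-- The Kronecker function `φ(u,z) = ϑ(u+z)ϑ'(0)/(ϑ(u)ϑ(z))`. -/
def kronPhi (τ u z : ℂ) : ℂ := theta τ (u + z) * deriv (theta τ) 0 / (theta τ u * theta τ z)

/-- `f(u,z) = ∂_u φ(u,z)`. -/
def kronF (τ u z : ℂ) : ℂ := deriv (fun u' => kronPhi τ u' z) u

/-- `e_N(z) = exp(2πiz/N)`. -/
def eN (N : ℕ) (z : ℂ) : ℂ := Complex.exp (2 * (Real.pi : ℂ) * Complex.I * z / N)

/-- The matrix `Q = diag(e_N(1),…,e_N(N−1),1)`. -/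
def Qm (N : ℕ) : Matrix (Fin N) (Fin N) ℂ :=
  Matrix.diagonal fun i => eN N ((i : ℕ) + 1)

/-- The cyclic shift matrix `Λ`. -/
def Lm (N : ℕ) : Matrix (Fin N) (Fin N) ℂ :=
  Matrix.of fun i j => if ((i : ℕ) + 1) % N = (j : ℕ) then 1 else 0

/-- The basis matrices `T_γ = e_N(γ₁γ₂/2) Q^{γ₁} Λ^{γ₂}` for `γ ∈ ℤ²`. -/
def Tm (N : ℕ) (γ : ℤ × ℤ) : Matrix (Fin N) (Fin N) ℂ :=
  eN N (((γ.1 * γ.2 : ℤ) : ℂ) / 2) • (Qm N ^ γ.1 * Lm N ^ γ.2)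

/-- `ω_γ = (γ₁ + γ₂τ)/N`. -/
def om (N : ℕ) (τ : ℂ) (γ : ℤ × ℤ) : ℂ := ((γ.1 : ℂ) + (γ.2 : ℂ) * τ) / N

/-- `φ_γ(z) = e_N(γ₂z) φ(ω_γ, z)`. -/
def phiG (N : ℕ) (τ : ℂ) (γ : ℤ × ℤ) (z : ℂ) : ℂ := eN N ((γ.2 : ℂ) * z) * kronPhi τ (om N τ γ) z

/-- `f_γ(z) = e_N(γ₂z) f(ω_γ, z)`. -/
def fG (N : ℕ) (τ : ℂ) (γ : ℤ × ℤ) (z : ℂ) : ℂ := eN N ((γ.2 : ℂ) * z) * kronF τ (om N τ γ) z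

/-- `F_γ(z) = φ_γ(z)E₁(z) − f_γ(z)`. -/
def FG (N : ℕ) (τ : ℂ) (γ : ℤ × ℤ) (z : ℂ) : ℂ := phiG N τ γ z * E1 τ z - fG N τ γ z

/-- A fixed set of representatives of the nonzero classes of `(ℤ/Nℤ)²`. -/
def GammaN' (N : ℕ) : Finset (ℤ × ℤ) :=
  ((Finset.range N ×ˢ Finset.range N).image fun p => ((p.1 : ℤ), (p.2 : ℤ))) \ {(0, 0)}


/-- The matrix `S^c(t) = ∑_{γ∈Γ'_N} S^c_γ(t) T_γ`. -/
def Smat (N : ℕ) {n : ℕ} (S : Fin n → (ℤ × ℤ) → ℝ → ℂ) (c : Fin n) (t : ℝ) :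
    Matrix (Fin N) (Fin N) ℂ :=
  ∑ γ ∈ GammaN' N, S c γ t • Tm N γ

/-- `φ̂_w(S^c(t)) = ∑_{γ∈Γ'_N} S^c_γ(t) φ_γ(w) T_γ`. -/
def phiHatS (N : ℕ) (τ : ℂ) {n : ℕ} (S : Fin n → (ℤ × ℤ) → ℝ → ℂ) (w : ℂ) (c : Fin n)
    (t : ℝ) : Matrix (Fin N) (Fin N) ℂ :=
  ∑ γ ∈ GammaN' N, (S c γ t * phiG N τ γ w) • Tm N γ


/-! ### The theta function -/

theorem theta_eq (τ z : ℂ) : theta τ z =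
    Complex.exp (2 * (Real.pi : ℂ) * Complex.I * τ / 8) *
      jacobiTheta₂ (z + 1 / 2 + τ / 2) τ := by
  unfold theta jacobiTheta₂
  congr 1
  refine tsum_congr fun m => ?_
  have h : (-1 : ℂ) ^ m = Complex.exp ((m : ℂ) * (Real.pi * Complex.I)) := by
    rw [Complex.exp_int_mul, Complex.exp_pi_mul_I]
  rw [h, jacobiTheta₂_term, ← Complex.exp_add]
  congr 1
  ring

theorem theta_add_one (τ z : ℂ) : theta τ (z + 1) = theta τ z := by
  rw [theta_eq, theta_eq, ← jacobiTheta₂_add_left (z + 1 / 2 + τ / 2)]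
  congr 2; ring

theorem theta_add_tau (τ z : ℂ) : theta τ (z + τ) =
    -Complex.exp (-(2 * Real.pi * Complex.I * (τ + z))) * theta τ z := by
  rw [theta_eq, theta_eq, show z + τ + 1 / 2 + τ / 2 = (z + 1 / 2 + τ / 2) + τ by ring,
    jacobiTheta₂_add_left']
  have : Complex.exp (-Real.pi * Complex.I * (τ + 2 * (z + 1 / 2 + τ / 2))) =
      -Complex.exp (-(2 * Real.pi * Complex.I * (τ + z))) := by
    rw [← mul_neg_one (Complex.exp (-(2 * Real.pi * Complex.I * (τ + z)))),
      ← Complex.exp_pi_mul_I, ← Complex.exp_add]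
    rw [Complex.exp_eq_exp_iff_exists_int]
    exact ⟨-1, by push_cast; ring⟩
  rw [this]; ring

theorem theta_differentiable (τ : ℂ) (hτ : 0 < τ.im) : Differentiable ℂ (theta τ) := by
  have : theta τ = fun z => Complex.exp (2 * (Real.pi : ℂ) * Complex.I * τ / 8) *
      jacobiTheta₂ (z + 1 / 2 + τ / 2) τ := funext (theta_eq τ)
  rw [this]
  intro z
  refine DifferentiableAt.const_mul ?_ _
  exact (differentiableAt_jacobiTheta₂_fst (z + 1 / 2 + τ / 2) hτ).comp z
    (f := fun z => z + 1 / 2 + τ / 2) (by fun_prop)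

/-- The genuinely odd theta function. -/
def th (τ z : ℂ) : ℂ := Complex.exp (Real.pi * Complex.I * z) * theta τ z

theorem th_add_one (τ z : ℂ) : th τ (z + 1) = - th τ z := by
  rw [th, th, theta_add_one, mul_add, Complex.exp_add, mul_one, Complex.exp_pi_mul_I]; ring

theorem th_add_tau (τ z : ℂ) : th τ (z + τ) =
    -Complex.exp (-(Real.pi * Complex.I * τ) - 2 * Real.pi * Complex.I * z) * th τ z := by
  rw [th, th, theta_add_tau]
  have : Complex.exp (Real.pi * Complex.I * (z + τ)) *
    Complex.exp (-(2 * Real.pi * Complex.I * (τ + z))) =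
    Complex.exp (-(Real.pi * Complex.I * τ) - 2 * Real.pi * Complex.I * z) *
      Complex.exp (Real.pi * Complex.I * z) := by
    rw [← Complex.exp_add, ← Complex.exp_add]; congr 1; ring
  linear_combination (-theta τ z) * this

theorem th_differentiable (τ : ℂ) (hτ : 0 < τ.im) : Differentiable ℂ (th τ) := by
  have := theta_differentiable τ hτ
  unfold th; fun_prop

theorem jacobi_int (τ : ℂ) (hτ : 0 < τ.im) (h : ∀ z, jacobiTheta₂ z τ = 0) : False := by
  have key := intervalIntegral.hasSum_integral_of_dominated_convergence
    (μ := MeasureTheory.volume) (a := (0:ℝ)) (b := 1)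
    (F := fun (n : ℤ) (x : ℝ) => jacobiTheta₂_term n (x : ℂ) τ)
    (f := fun x : ℝ => jacobiTheta₂ (x : ℂ) τ)
    (fun n _ => ‖jacobiTheta₂_term n 0 τ‖)
    (fun n => by
      unfold jacobiTheta₂_term
      exact (by fun_prop : Continuous _).aestronglyMeasurable)
    (fun n => by
      filter_upwards with x _
      rw [norm_jacobiTheta₂_term, norm_jacobiTheta₂_term]; simp)
    (by
      filter_upwards with x _
      exact ((summable_jacobiTheta₂_term_iff 0 τ).mpr hτ).norm)
    (by simp)
    (by
      filter_upwards with x _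
      exact hasSum_jacobiTheta₂_term _ hτ)
  simp only [h, intervalIntegral.integral_zero] at key
  have h0 : ∀ n : ℤ, n ≠ 0 → (∫ x in (0:ℝ)..1, jacobiTheta₂_term n (x : ℂ) τ) = 0 := by
    intro n hn
    have hc : (2 * Real.pi * Complex.I * n : ℂ) ≠ 0 := by
      simp [Real.pi_ne_zero, hn]
    simp only [jacobiTheta₂_term, Complex.exp_add]
    rw [intervalIntegral.integral_mul_const, integral_exp_mul_complex hc]
    simp [mul_comm _ (n : ℂ), Complex.exp_int_mul_two_pi_mul_I]
  have h1 := hasSum_single (f := fun n : ℤ => ∫ x in (0:ℝ)..1, jacobiTheta₂_term n (x : ℂ) τ) 0 h0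
  have h2 := key.unique h1
  simp [jacobiTheta₂_term] at h2

theorem th_ne_zero (τ : ℂ) (hτ : 0 < τ.im) : ∃ z, th τ z ≠ 0 := by
  by_contra hcon
  push Not at hcon
  refine jacobi_int τ hτ fun z => ?_
  have := hcon (z - 1 / 2 - τ / 2)
  rw [th, theta_eq, show z - 1 / 2 - τ / 2 + 1 / 2 + τ / 2 = z by ring] at this
  simpa [Complex.exp_ne_zero] using this

/-- Reparametrisation of `ℤ × ℤ` by the parity of the sum of coordinates. -/
def parityMap : (ℤ × ℤ) ⊕ (ℤ × ℤ) → ℤ × ℤ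
  | Sum.inl p => (p.1 + p.2, p.1 - p.2)
  | Sum.inr p => (p.1 + p.2 + 1, p.1 - p.2)

theorem parityMap_bij : Function.Bijective parityMap := by
  constructor
  · rintro (⟨a, b⟩ | ⟨a, b⟩) (⟨c, d⟩ | ⟨c, d⟩) h <;> simp only [parityMap, Prod.mk.injEq] at h
    · have h1 : a = c := by omega
      have h2 : b = d := by omega
      rw [h1, h2]
    · omega
    · omega
    · have h1 : a = c := by omega
      have h2 : b = d := by omega
      rw [h1, h2]
  · rintro ⟨m, k⟩
    rcases Int.even_or_odd' (m + k) with ⟨c, hc | hc⟩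
    · exact ⟨Sum.inl (c, m - c), by simp only [parityMap, Prod.mk.injEq]; omega⟩
    · exact ⟨Sum.inr (c, c - k), by simp only [parityMap, Prod.mk.injEq]; omega⟩

theorem hasSum_of_eq {f g : ℤ × ℤ → ℂ} {a : ℂ} (hg : HasSum g a) (h : ∀ p, f p = g p) :
    HasSum f a := by
  rwa [funext h]

theorem hasSum_mul_gen (f g : ℤ → ℂ) (a b : ℂ) (hf : HasSum f a) (hg : HasSum g b)
    (hf' : Summable fun n => ‖f n‖) (hg' : Summable fun n => ‖g n‖) :
    HasSum (fun p : ℤ × ℤ => f p.1 * g p.2) (a * b) :=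
  hf.mul hg (summable_mul_of_summable_norm hf' hg')

theorem hasSum_mul_jac (z w τ : ℂ) (hτ : 0 < τ.im) :
    HasSum (fun p : ℤ × ℤ => jacobiTheta₂_term p.1 z τ * jacobiTheta₂_term p.2 w τ)
      (jacobiTheta₂ z τ * jacobiTheta₂ w τ) :=
  hasSum_mul_gen (fun n => jacobiTheta₂_term n z τ) (fun n => jacobiTheta₂_term n w τ) _ _
    (hasSum_jacobiTheta₂_term z hτ) (hasSum_jacobiTheta₂_term w hτ)
    ((summable_jacobiTheta₂_term_iff z τ).mpr hτ).norm
    ((summable_jacobiTheta₂_term_iff w τ).mpr hτ).norm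

theorem jac_mul (τ x y : ℂ) (hτ : 0 < τ.im) :
    jacobiTheta₂ (x + y + 1 / 2 + τ / 2) τ * jacobiTheta₂ (x - y + 1 / 2 + τ / 2) τ =
    jacobiTheta₂ (2 * x + τ) (2 * τ) * jacobiTheta₂ (2 * y) (2 * τ) -
    Complex.exp (2 * Real.pi * Complex.I * (y - x)) *
      (jacobiTheta₂ (2 * x) (2 * τ) * jacobiTheta₂ (2 * y + τ) (2 * τ)) := by
  have h2τ : 0 < (2 * τ).im := by simpa using hτ
  have hL := hasSum_mul_jac (x + y + 1 / 2 + τ / 2) (x - y + 1 / 2 + τ / 2) τ hτ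
  have hE := hasSum_mul_jac (2 * x + τ) (2 * y) (2 * τ) h2τ
  have hO := hasSum_mul_jac (2 * x) (2 * y + τ) (2 * τ) h2τ
  have hO2 := (((Equiv.addRight (1 : ℤ)).prodCongr (Equiv.refl ℤ)).hasSum_iff.mpr hO).mul_left
    (-Complex.exp (2 * Real.pi * Complex.I * (y - x)))
  rw [← (Equiv.ofBijective _ parityMap_bij).hasSum_iff] at hL
  rw [sub_eq_add_neg (_ * _), ← neg_mul]
  refine hL.unique (HasSum.sum ?_ ?_)
  · refine hasSum_of_eq hE ?_
    rintro ⟨k, l⟩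
    simp only [Function.comp, Equiv.ofBijective_apply, parityMap, jacobiTheta₂_term,
      ← Complex.exp_add]
    rw [Complex.exp_eq_exp_iff_exists_int]
    exact ⟨k, by push_cast; ring⟩
  · refine hasSum_of_eq hO2 ?_
    rintro ⟨k, l⟩
    simp only [Function.comp, Equiv.ofBijective_apply, parityMap, jacobiTheta₂_term,
      Equiv.prodCongr_apply, Prod.map, Equiv.coe_addRight, Equiv.refl_apply]
    rw [← mul_neg_one (Complex.exp (2 * Real.pi * Complex.I * (y - x))), ← Complex.exp_pi_mul_I]
    simp only [← Complex.exp_add]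
    rw [Complex.exp_eq_exp_iff_exists_int]
    exact ⟨k, by push_cast; ring⟩

/-- First building block of the addition formula. -/
def thA (τ x : ℂ) : ℂ := Complex.exp (2 * (Real.pi : ℂ) * Complex.I * τ / 4) *
  Complex.exp (2 * Real.pi * Complex.I * x) * jacobiTheta₂ (2 * x + τ) (2 * τ)

/-- Second building block of the addition formula. -/
def thB (τ x : ℂ) : ℂ := jacobiTheta₂ (2 * x) (2 * τ)

theorem th_mul (τ x y : ℂ) (hτ : 0 < τ.im) :
    th τ (x + y) * th τ (x - y) = thA τ x * thB τ y - thB τ x * thA τ y := by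
  have h := jac_mul τ x y hτ
  rw [th, th, theta_eq, theta_eq, thA, thA, thB, thB]
  have e1 : Complex.exp (Real.pi * Complex.I * (x + y)) * Complex.exp (Real.pi * Complex.I * (x - y))
      = Complex.exp (2 * Real.pi * Complex.I * x) := by
    rw [← Complex.exp_add]; congr 1; ring
  have e2 : Complex.exp (2 * (Real.pi : ℂ) * Complex.I * τ / 8) *
      Complex.exp (2 * (Real.pi : ℂ) * Complex.I * τ / 8) =
      Complex.exp (2 * (Real.pi : ℂ) * Complex.I * τ / 4) := by
    rw [← Complex.exp_add]; congr 1; ring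
  have e3 : Complex.exp (2 * Real.pi * Complex.I * x) *
      Complex.exp (2 * Real.pi * Complex.I * (y - x)) = Complex.exp (2 * Real.pi * Complex.I * y) := by
    rw [← Complex.exp_add]; congr 1; ring
  rw [← e3, ← e2, ← e1]
  linear_combination Complex.exp (Real.pi * Complex.I * (x + y)) *
    Complex.exp (Real.pi * Complex.I * (x - y)) *
    Complex.exp (2 * (Real.pi : ℂ) * Complex.I * τ / 8) *
      Complex.exp (2 * (Real.pi : ℂ) * Complex.I * τ / 8) * h

theorem thA_differentiable (τ : ℂ) (hτ : 0 < τ.im) : Differentiable ℂ (thA τ) := by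
  have h2τ : 0 < (2 * τ).im := by simpa using hτ
  intro x
  unfold thA
  refine DifferentiableAt.mul (by fun_prop) ?_
  exact (differentiableAt_jacobiTheta₂_fst (2 * x + τ) h2τ).comp x
    (f := fun x => 2 * x + τ) (by fun_prop)

theorem thB_differentiable (τ : ℂ) (hτ : 0 < τ.im) : Differentiable ℂ (thB τ) := by
  have h2τ : 0 < (2 * τ).im := by simpa using hτ
  intro x
  unfold thB
  exact (differentiableAt_jacobiTheta₂_fst (2 * x) h2τ).comp x
    (f := fun x => 2 * x) (by fun_prop)

/-- Weierstrass three-term identity. -/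
theorem th_three (τ : ℂ) (hτ : 0 < τ.im) (p q r s : ℂ) :
    th τ (p + q) * th τ (p - q) * (th τ (r + s) * th τ (r - s))
    - th τ (p + r) * th τ (p - r) * (th τ (q + s) * th τ (q - s))
    + th τ (p + s) * th τ (p - s) * (th τ (q + r) * th τ (q - r)) = 0 := by
  simp only [th_mul τ _ _ hτ]; ring

theorem th_zero (τ : ℂ) (hτ : 0 < τ.im) : th τ 0 = 0 := by
  obtain ⟨z, hz⟩ := th_ne_zero τ hτ
  have := th_mul τ (z / 2) (z / 2) hτ
  rw [add_halves, sub_self, mul_comm (thB _ _), sub_self] at this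
  exact (mul_eq_zero.mp this).resolve_left hz

theorem th_neg (τ : ℂ) (hτ : 0 < τ.im) (z : ℂ) : th τ (-z) = - th τ z := by
  obtain ⟨w, hw⟩ := th_ne_zero τ hτ
  have h1 := th_mul τ ((w + z) / 2) ((w - z) / 2) hτ
  have h2 := th_mul τ ((w - z) / 2) ((w + z) / 2) hτ
  rw [show (w + z) / 2 + (w - z) / 2 = w by ring, show (w + z) / 2 - (w - z) / 2 = z by ring] at h1
  rw [show (w - z) / 2 + (w + z) / 2 = w by ring, show (w - z) / 2 - (w + z) / 2 = -z by ring] at h2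
  apply mul_left_cancel₀ hw
  rw [h2]; linear_combination h1

/-! ### Zeros of the theta function -/

theorem wronskian_zero (f g : ℂ → ℂ) (hf : Differentiable ℂ f) (hg : Differentiable ℂ g) (x₀ : ℂ)
    (h0 : f x₀ ≠ 0) (h : ∀ x, deriv g x * f x = g x * deriv f x) :
    ∃ C, ∀ x, g x = C * f x := by
  have hev : ∀ᶠ x in nhds x₀, f x ≠ 0 := hf.continuous.continuousAt.eventually_ne h0
  obtain ⟨ε, hε, hball⟩ := Metric.eventually_nhds_iff_ball.mp hev
  obtain ⟨C, hC⟩ := (Metric.isOpen_ball (x := x₀) (ε := ε)).exists_is_const_of_deriv_eq_zero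
    (f := fun x => g x / f x) (convex_ball x₀ ε).isPreconnected
    (fun x hx => ((hg x).div (hf x) (hball x hx)).differentiableWithinAt)
    (fun x hx => by
      have := ((hg x).hasDerivAt.div (hf x).hasDerivAt (hball x hx)).deriv
      simp only [Pi.zero_apply]
      refine this.trans ?_
      rw [h x, sub_self, zero_div])
  refine ⟨C, fun x => ?_⟩
  have ha : AnalyticOnNhd ℂ g Set.univ := hg.differentiableOn.analyticOnNhd isOpen_univ
  have hb : AnalyticOnNhd ℂ (fun x => C * f x) Set.univ :=
    (hf.const_mul C).differentiableOn.analyticOnNhd isOpen_univ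
  have he : g =ᶠ[nhds x₀] fun x => C * f x := by
    filter_upwards [Metric.ball_mem_nhds x₀ hε] with x hx
    have := hC x hx
    have h1 := hball x hx
    field_simp at this
    rw [this]; ring
  exact congrFun (ha.eq_of_eventuallyEq hb he) x

theorem multiplicative_exp (f g : ℂ → ℂ) (hf : Differentiable ℂ f) (hg : Differentiable ℂ g) (p : ℂ)
    (hfp : f p ≠ 0) (hgp : g p ≠ 0)
    (h : ∀ a b, g (p + a + b) * g p * (f (p + a) * f (p + b)) =
      g (p + a) * g (p + b) * (f (p + a + b) * f p)) :
    ∃ l C, ∀ x, g x = C * (Complex.exp (l * x) * f x) := by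
  set l := deriv g p / g p - deriv f p / f p with hl
  have key : ∀ q, deriv g q * f q - g q * deriv f q = l * (g q * f q) := by
    intro q
    have d1 : ∀ (F : ℂ → ℂ), Differentiable ℂ F → ∀ c : ℂ,
        HasDerivAt (fun b => F (c + b)) (deriv F c) 0 := by
      intro F hF c
      apply HasDerivAt.comp_const_add
      simpa using (hF c).hasDerivAt
    have hL := ((d1 g hg q).mul_const (g p)).mul ((d1 f hf p).const_mul (f q))
    have hR := ((d1 g hg p).const_mul (g q)).mul ((d1 f hf q).mul_const (f p))
    have he : ((fun b => g (q + b) * g p) * fun b => f q * f (p + b)) =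
        ((fun b => g q * g (p + b)) * fun b => f (q + b) * f p) := by
      funext b
      have := h (q - p) b
      rw [show p + (q - p) = q by ring] at this
      simpa using this
    rw [he] at hL
    have := hL.unique hR
    simp only [add_zero] at this
    rw [hl]
    field_simp
    linear_combination this
  have hW : Differentiable ℂ fun x => Complex.exp (-(l * x)) * g x := by fun_prop
  obtain ⟨C, hC⟩ := wronskian_zero f (fun x => Complex.exp (-(l * x)) * g x) hf hW p hfp (by
    intro x
    have hx : HasDerivAt (fun x : ℂ => Complex.exp (-(l * x))) (Complex.exp (-(l * x)) * -l) x := by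
      have : HasDerivAt (fun x : ℂ => -(l * x)) (-l) x := by
        simpa using (hasDerivAt_id x).const_mul (-l)
      exact this.cexp
    have := (hx.mul (hg x).hasDerivAt).deriv
    have h2 : deriv (fun x => Complex.exp (-(l * x)) * g x) x = _ := this
    rw [h2]
    linear_combination Complex.exp (-(l * x)) * key x)
  refine ⟨l, C, fun x => ?_⟩
  have := hC x
  have h3 : Complex.exp (l * x) * Complex.exp (-(l * x)) = 1 := by
    rw [← Complex.exp_add]; simp
  linear_combination Complex.exp (l * x) * this - g x * h3

theorem th_eq_zero (τ : ℂ) (hτ : 0 < τ.im) (z₀ : ℂ) (h0 : th τ z₀ = 0) :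
    z₀ ∈ latticeGamma τ := by
  have hd := th_differentiable τ hτ
  have hg : Differentiable ℂ fun x => th τ (x + z₀) := by fun_prop
  obtain ⟨p, hp, hgp⟩ : ∃ p, th τ p ≠ 0 ∧ th τ (p + z₀) ≠ 0 := by
    by_contra hcon
    push Not at hcon
    have ha : AnalyticOnNhd ℂ (th τ) Set.univ := hd.differentiableOn.analyticOnNhd isOpen_univ
    have hb : AnalyticOnNhd ℂ (fun x => th τ (x + z₀)) Set.univ :=
      hg.differentiableOn.analyticOnNhd isOpen_univ
    obtain ⟨w, hw⟩ := th_ne_zero τ hτ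
    rcases ha.eq_zero_or_eq_zero_of_mul_eq_zero hb (fun x _ => by
      by_cases hx : th τ x = 0
      · simp [hx]
      · simp [hcon x hx]) isPreconnected_univ with h | h
    · exact hw (h w trivial)
    · have := h (w - z₀) trivial
      simp at this
      exact hw this
  obtain ⟨l, C, hC⟩ := multiplicative_exp (th τ) (fun x => th τ (x + z₀)) hd hg p hp hgp (by
    intro a b
    have := th_three τ hτ (p + (a + b) / 2 + z₀) (p + (a + b) / 2) ((a + b) / 2) ((a - b) / 2)
    rw [show p + (a + b) / 2 + z₀ - (p + (a + b) / 2) = z₀ by ring, h0,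
      show p + (a + b) / 2 + z₀ + (a + b) / 2 = p + a + b + z₀ by ring,
      show p + (a + b) / 2 + z₀ - (a + b) / 2 = p + z₀ by ring,
      show p + (a + b) / 2 + (a - b) / 2 = p + a by ring,
      show p + (a + b) / 2 - (a - b) / 2 = p + b by ring,
      show p + (a + b) / 2 + z₀ + (a - b) / 2 = p + a + z₀ by ring,
      show p + (a + b) / 2 + z₀ - (a - b) / 2 = p + b + z₀ by ring,
      show p + (a + b) / 2 + (a + b) / 2 = p + a + b by ring,
      show p + (a + b) / 2 - (a + b) / 2 = p by ring] at this
    linear_combination -this)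
  have hC0 : C * (Complex.exp (l * p) * th τ p) ≠ 0 := by rw [← hC p]; exact hgp
  have h1 : Complex.exp l = 1 := by
    have h := hC (p + 1)
    rw [show p + 1 + z₀ = p + z₀ + 1 by ring, th_add_one, th_add_one, hC p, mul_add,
      Complex.exp_add, mul_one] at h
    apply mul_left_cancel₀ hC0
    linear_combination h
  have h2 : Complex.exp (l * τ) = Complex.exp (-(2 * Real.pi * Complex.I * z₀)) := by
    have h := hC (p + τ)
    rw [show p + τ + z₀ = p + z₀ + τ by ring, th_add_tau, th_add_tau, hC p, mul_add l,
      Complex.exp_add (l * p)] at h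
    have e : Complex.exp (-(Real.pi * Complex.I * τ) - 2 * Real.pi * Complex.I * (p + z₀)) =
      Complex.exp (-(Real.pi * Complex.I * τ) - 2 * Real.pi * Complex.I * p) *
        Complex.exp (-(2 * Real.pi * Complex.I * z₀)) := by
      rw [← Complex.exp_add]; congr 1; ring
    rw [e] at h
    apply mul_left_cancel₀ (mul_ne_zero (Complex.exp_ne_zero
      (-(Real.pi * Complex.I * τ) - 2 * Real.pi * Complex.I * p)) hC0)
    linear_combination h
  obtain ⟨k, hk⟩ := Complex.exp_eq_one_iff.mp h1
  obtain ⟨m, hm⟩ := Complex.exp_eq_exp_iff_exists_int.mp h2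
  refine ⟨m, -k, ?_⟩
  rw [hk] at hm
  have hpi : (2 * Real.pi * Complex.I : ℂ) ≠ 0 := by simp [Real.pi_ne_zero]
  apply mul_left_cancel₀ hpi
  push_cast
  linear_combination hm

theorem th_lattice (τ : ℂ) (hτ : 0 < τ.im) (z : ℂ) : th τ z = 0 ↔ z ∈ latticeGamma τ := by
  refine ⟨th_eq_zero τ hτ z, ?_⟩
  rintro ⟨m, k, rfl⟩
  have p1 : Function.Periodic (fun z => th τ z = 0) 1 := by
    intro z; simp [th_add_one]
  have p2 : Function.Periodic (fun z => th τ z = 0) τ := by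
    intro z; simp [th_add_tau, Complex.exp_ne_zero]
  have h1 := p1.int_mul m 0
  have h2 := p2.int_mul k (m : ℂ)
  simp only [zero_add, mul_one] at h1 h2
  rw [h2, h1]
  exact th_zero τ hτ

theorem th_deriv_ne (τ : ℂ) (hτ : 0 < τ.im) : deriv (th τ) 0 ≠ 0 := by
  intro h0
  have hd := th_differentiable τ hτ
  have hA := thA_differentiable τ hτ
  have hB := thB_differentiable τ hτ
  obtain ⟨w, hw⟩ := th_ne_zero τ hτ
  have hW : ∀ x, deriv (thB τ) x * thA τ x = thB τ x * deriv (thA τ) x := by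
    intro x
    have d1 : ∀ (F : ℂ → ℂ), Differentiable ℂ F → ∀ c : ℂ,
        HasDerivAt (fun b => F (c + b)) (deriv F c) 0 := by
      intro F hF c
      apply HasDerivAt.comp_const_add
      simpa using (hF c).hasDerivAt
    have hL := (d1 (th τ) hd (2 * x)).mul (d1 (th τ) hd 0)
    have hR := ((d1 _ hA x).mul_const (thB τ x)).sub ((d1 _ hB x).mul_const (thA τ x))
    have he : ((fun b => th τ (2 * x + b)) * fun b => th τ (0 + b)) =
        ((fun b => thA τ (x + b) * thB τ x) - fun b => thB τ (x + b) * thA τ x) := by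
      funext b
      have := th_mul τ (x + b) x hτ
      rw [show x + b + x = 2 * x + b by ring, show x + b - x = 0 + b by ring] at this
      simpa using this
    rw [he] at hL
    have := hL.unique hR
    rw [h0, add_zero, th_zero τ hτ] at this
    linear_combination this
  have hm := th_mul τ (w / 2 + w / 2) 0 hτ
  rw [add_zero, sub_zero, add_halves] at hm
  by_cases hA0 : ∃ x, thA τ x ≠ 0
  · obtain ⟨x, hx⟩ := hA0
    obtain ⟨C, hC⟩ := wronskian_zero (thA τ) (thB τ) hA hB x hx hW
    rw [hC, hC] at hm
    exact mul_ne_zero hw hw (hm.trans (by ring))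
  · push Not at hA0
    rw [hA0, hA0] at hm
    exact mul_ne_zero hw hw (hm.trans (by ring))

theorem theta_zero (τ : ℂ) (hτ : 0 < τ.im) : theta τ 0 = 0 := by
  have := th_zero τ hτ
  rw [th] at this
  simpa [Complex.exp_ne_zero] using this

theorem theta_deriv (τ : ℂ) (hτ : 0 < τ.im) : deriv (theta τ) 0 = deriv (th τ) 0 := by
  have hx : HasDerivAt (fun x : ℂ => Complex.exp (Real.pi * Complex.I * x))
      (Complex.exp (Real.pi * Complex.I * 0) * (Real.pi * Complex.I)) 0 := by
    have : HasDerivAt (fun x : ℂ => Real.pi * Complex.I * x) (Real.pi * Complex.I) 0 := by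
      simpa using (hasDerivAt_id (0 : ℂ)).const_mul (Real.pi * Complex.I)
    exact this.cexp
  have := (hx.mul (theta_differentiable τ hτ 0).hasDerivAt).deriv
  have h2 : deriv (th τ) 0 = _ := this
  rw [h2, theta_zero τ hτ]
  simp

/-! ### The Kronecker function -/

theorem kronPhi_eq (τ : ℂ) (hτ : 0 < τ.im) (u z : ℂ) :
    kronPhi τ u z = th τ (u + z) * deriv (th τ) 0 / (th τ u * th τ z) := by
  rw [kronPhi, theta_deriv τ hτ]
  simp only [th]
  rw [mul_add, Complex.exp_add]
  have h1 := Complex.exp_ne_zero (Real.pi * Complex.I * u)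
  have h2 := Complex.exp_ne_zero (Real.pi * Complex.I * z)
  rw [show Complex.exp (Real.pi * Complex.I * u) * Complex.exp (Real.pi * Complex.I * z) *
      theta τ (u + z) * deriv (th τ) 0 = (Complex.exp (Real.pi * Complex.I * u) *
      Complex.exp (Real.pi * Complex.I * z)) * (theta τ (u + z) * deriv (th τ) 0) by ring,
    show Complex.exp (Real.pi * Complex.I * u) * theta τ u *
      (Complex.exp (Real.pi * Complex.I * z) * theta τ z) = (Complex.exp (Real.pi * Complex.I * u) *
      Complex.exp (Real.pi * Complex.I * z)) * (theta τ u * theta τ z) by ring,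
    mul_div_mul_left _ _ (mul_ne_zero h1 h2)]

theorem kronPhi_fay (τ : ℂ) (hτ : 0 < τ.im) (u v x y : ℂ) (hu : u ∉ latticeGamma τ)
    (hv : v ∉ latticeGamma τ) (huv : u + v ∉ latticeGamma τ) (hx : x ∉ latticeGamma τ)
    (hy : y ∉ latticeGamma τ) (hxy : x - y ∉ latticeGamma τ) :
    kronPhi τ u x * kronPhi τ v y = kronPhi τ u (x - y) * kronPhi τ (u + v) y
      + kronPhi τ v (y - x) * kronPhi τ (u + v) x := by
  rw [← th_lattice τ hτ] at hu hv huv hx hy hxy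
  simp only [kronPhi_eq τ hτ]
  have h := th_three τ hτ ((u + x + v + y) / 2) ((u + x - v - y) / 2) ((u + v + x - y) / 2)
    ((u + v - x + y) / 2)
  rw [show (u + x + v + y) / 2 + (u + x - v - y) / 2 = u + x by ring,
    show (u + x + v + y) / 2 - (u + x - v - y) / 2 = v + y by ring,
    show (u + v + x - y) / 2 + (u + v - x + y) / 2 = u + v by ring,
    show (u + v + x - y) / 2 - (u + v - x + y) / 2 = x - y by ring,
    show (u + x + v + y) / 2 + (u + v + x - y) / 2 = u + v + x by ring,
    show (u + x + v + y) / 2 - (u + v + x - y) / 2 = y by ring,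
    show (u + x - v - y) / 2 + (u + v - x + y) / 2 = u by ring,
    show (u + x - v - y) / 2 - (u + v - x + y) / 2 = -(v + (y - x)) by ring,
    show (u + x + v + y) / 2 + (u + v - x + y) / 2 = u + v + y by ring,
    show (u + x + v + y) / 2 - (u + v - x + y) / 2 = x by ring,
    show (u + x - v - y) / 2 + (u + v + x - y) / 2 = u + (x - y) by ring,
    show (u + x - v - y) / 2 - (u + v + x - y) / 2 = -v by ring,
    th_neg τ hτ, th_neg τ hτ] at h
  rw [show th τ (y - x) = - th τ (x - y) by rw [← th_neg τ hτ]; congr 1; ring]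
  generalize th τ (u + (x - y)) = t1 at *
  generalize th τ (v + (y - x)) = t2 at *
  generalize th τ (u + v + x) = t3 at *
  generalize th τ (u + v + y) = t4 at *
  generalize th τ (u + x) = t5 at *
  generalize th τ (v + y) = t6 at *
  generalize th τ (u + v) = t7 at *
  generalize th τ (x - y) = t8 at *
  field_simp
  linear_combination (deriv (th τ) 0) ^ 2 * h

theorem kronPhi_add_one (τ : ℂ) (hτ : 0 < τ.im) (u z : ℂ) :
    kronPhi τ (u + 1) z = kronPhi τ u z := by
  rw [kronPhi_eq τ hτ, kronPhi_eq τ hτ, show u + 1 + z = u + z + 1 by ring, th_add_one, th_add_one,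
    neg_mul, neg_mul, neg_div_neg_eq]

theorem kronPhi_add_tau (τ : ℂ) (hτ : 0 < τ.im) (u z : ℂ) :
    kronPhi τ (u + τ) z = Complex.exp (-(2 * Real.pi * Complex.I * z)) * kronPhi τ u z := by
  rw [kronPhi_eq τ hτ, kronPhi_eq τ hτ, show u + τ + z = u + z + τ by ring, th_add_tau, th_add_tau]
  have e : Complex.exp (-(Real.pi * Complex.I * τ) - 2 * Real.pi * Complex.I * (u + z)) =
      Complex.exp (-(Real.pi * Complex.I * τ) - 2 * Real.pi * Complex.I * u) *
        Complex.exp (-(2 * Real.pi * Complex.I * z)) := by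
      rw [← Complex.exp_add]; congr 1; ring
  rw [e]
  have h1 := Complex.exp_ne_zero (-(Real.pi * Complex.I * τ) - 2 * Real.pi * Complex.I * u)
  generalize Complex.exp (-(Real.pi * Complex.I * τ) - 2 * Real.pi * Complex.I * u) = E at *
  generalize Complex.exp (-(2 * Real.pi * Complex.I * z)) = F at *
  rw [show -(E * F) * th τ (u + z) * deriv (th τ) 0 = (-E) * (F * (th τ (u + z) * deriv (th τ) 0))
    by ring, show -E * th τ u * th τ z = (-E) * (th τ u * th τ z) by ring,
    mul_div_mul_left _ _ (neg_ne_zero.mpr h1), mul_div_assoc]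

theorem phiG_period1 (N : ℕ) (hN : 2 ≤ N) (τ : ℂ) (hτ : 0 < τ.im) (a b : ℤ) (z : ℂ) :
    phiG N τ (a % N, b) z = phiG N τ (a, b) z := by
  have hN0 : (N : ℂ) ≠ 0 := by exact_mod_cast (by omega : N ≠ 0)
  have hp : Function.Periodic (fun a : ℤ => phiG N τ (a, b) z) (N : ℤ) := by
    intro a
    simp only [phiG, om]
    rw [← kronPhi_add_one τ hτ ((↑a + ↑b * τ) / ↑N)]
    congr 2
    push_cast
    field_simp
    ring
  have : phiG N τ (a % N + _ * _, b) z = phiG N τ (a % N, b) z := hp.int_mul (a / N) (a % N)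
  rw [← this, Int.cast_id, mul_comm, Int.emod_add_mul_ediv]

theorem phiG_period2 (N : ℕ) (hN : 2 ≤ N) (τ : ℂ) (hτ : 0 < τ.im) (a b : ℤ) (z : ℂ) :
    phiG N τ (a, b % N) z = phiG N τ (a, b) z := by
  have hN0 : (N : ℂ) ≠ 0 := by exact_mod_cast (by omega : N ≠ 0)
  have hp : Function.Periodic (fun b : ℤ => phiG N τ (a, b) z) (N : ℤ) := by
    intro b
    simp only [phiG, om, eN]
    rw [show ((a : ℂ) + ((b + (N : ℤ) : ℤ) : ℂ) * τ) / N = (a + b * τ) / N + τ by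
      push_cast; field_simp; ring, kronPhi_add_tau τ hτ, ← mul_assoc, ← Complex.exp_add]
    congr 2
    push_cast
    field_simp
    ring
  have : phiG N τ (a, b % N + _ * _) z = phiG N τ (a, b % N) z := hp.int_mul (b / N) (b % N)
  rw [← this, Int.cast_id, mul_comm, Int.emod_add_mul_ediv]

/-- Reduction mod `N`. -/
def redN (N : ℕ) (γ : ℤ × ℤ) : ℤ × ℤ := (γ.1 % N, γ.2 % N)

theorem phiG_red (N : ℕ) (hN : 2 ≤ N) (τ : ℂ) (hτ : 0 < τ.im) (γ : ℤ × ℤ) (z : ℂ) :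
    phiG N τ (redN N γ) z = phiG N τ γ z := by
  rw [redN, phiG_period1 N hN τ hτ, phiG_period2 N hN τ hτ]

theorem om_not_mem (N : ℕ) (hN : 2 ≤ N) (τ : ℂ) (hτ : 0 < τ.im) (γ : ℤ × ℤ)
    (h : redN N γ ≠ (0, 0)) : om N τ γ ∉ latticeGamma τ := by
  rintro ⟨m, k, hmk⟩
  apply h
  have hN0 : (N : ℂ) ≠ 0 := by exact_mod_cast (by omega : N ≠ 0)
  rw [om, div_eq_iff hN0] at hmk
  have him := congrArg Complex.im hmk
  simp at him
  have h2 : (γ.2 : ℝ) = k * N := by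
    apply mul_right_cancel₀ hτ.ne'
    linear_combination him
  have h2' : (γ.2 : ℂ) = k * N := by exact_mod_cast h2
  have h1 : (γ.1 : ℂ) = m * N := by
    rw [h2'] at hmk
    linear_combination hmk
  have h1' : γ.1 = m * N := by exact_mod_cast h1
  have h2'' : γ.2 = k * N := by exact_mod_cast h2
  simp [redN, h1', h2'']

theorem phiG_fay (N : ℕ) (hN : 2 ≤ N) (τ : ℂ) (hτ : 0 < τ.im) (α β : ℤ × ℤ) (x y : ℂ)
    (hα : redN N α ≠ (0, 0)) (hβ : redN N β ≠ (0, 0)) (hαβ : redN N (α + β) ≠ (0, 0))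
    (hx : x ∉ latticeGamma τ) (hy : y ∉ latticeGamma τ) (hxy : x - y ∉ latticeGamma τ) :
    phiG N τ α x * phiG N τ β y = phiG N τ α (x - y) * phiG N τ (redN N (α + β)) y
      + phiG N τ β (y - x) * phiG N τ (redN N (α + β)) x := by
  rw [phiG_red N hN τ hτ, phiG_red N hN τ hτ]
  have ho : om N τ (α + β) = om N τ α + om N τ β := by
    simp only [om, Prod.fst_add, Prod.snd_add]; push_cast; ring
  have h := kronPhi_fay τ hτ (om N τ α) (om N τ β) x y (om_not_mem N hN τ hτ α hα)
    (om_not_mem N hN τ hτ β hβ) (ho ▸ om_not_mem N hN τ hτ _ hαβ) hx hy hxy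
  simp only [phiG, ho]
  have e1 : eN N ((α.2 : ℂ) * (x - y)) * eN N (((α + β).2 : ℂ) * y) =
      eN N (α.2 * x) * eN N (β.2 * y) := by
    simp only [eN, ← Complex.exp_add, Prod.snd_add]; congr 1; push_cast; ring
  have e2 : eN N ((β.2 : ℂ) * (y - x)) * eN N (((α + β).2 : ℂ) * x) =
      eN N (α.2 * x) * eN N (β.2 * y) := by
    simp only [eN, ← Complex.exp_add, Prod.snd_add]; congr 1; push_cast; ring
  linear_combination eN N (α.2 * x) * eN N (β.2 * y) * h
    - kronPhi τ (om N τ α) (x - y) * kronPhi τ (om N τ α + om N τ β) y * e1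
    - kronPhi τ (om N τ β) (y - x) * kronPhi τ (om N τ α + om N τ β) x * e2

/-! ### Residues -/

theorem phiG_residue (N : ℕ) (hN : 2 ≤ N) (τ : ℂ) (hτ : 0 < τ.im) (γ : ℤ × ℤ)
    (hγ : redN N γ ≠ (0, 0)) :
    Filter.Tendsto (fun x => x * phiG N τ γ x) (nhdsWithin 0 {0}ᶜ) (nhds 1) := by
  have hd := th_differentiable τ hτ
  have hω : th τ (om N τ γ) ≠ 0 := fun h =>
    om_not_mem N hN τ hτ γ hγ ((th_lattice τ hτ _).mp h)
  have hd0 := th_deriv_ne τ hτ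
  have h1 := (hasDerivAt_iff_tendsto_slope_zero.mp (hd 0).hasDerivAt).inv₀ hd0
  have h2 : Continuous fun x => eN N ((γ.2 : ℂ) * x) * (th τ (om N τ γ + x) * deriv (th τ) 0 /
      th τ (om N τ γ)) := by
    have := hd.continuous
    unfold eN
    fun_prop
  have h3 := (h2.tendsto 0).mono_left (nhdsWithin_le_nhds (s := {0}ᶜ))
  have h4 := h3.mul h1
  have e : eN N ((γ.2 : ℂ) * 0) * (th τ (om N τ γ + 0) * deriv (th τ) 0 /
      th τ (om N τ γ)) * (deriv (th τ) 0)⁻¹ = 1 := by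
    rw [mul_zero, add_zero]
    simp only [eN, mul_zero, zero_div, Complex.exp_zero]
    field_simp
  rw [e] at h4
  refine h4.congr fun x => ?_
  rw [phiG, kronPhi_eq τ hτ, zero_add, th_zero τ hτ, sub_zero, smul_eq_mul, mul_inv, inv_inv]
  rw [div_eq_mul_inv, div_eq_mul_inv, mul_inv]
  ring

theorem phiG_continuousAt (N : ℕ) (τ : ℂ) (hτ : 0 < τ.im) (γ : ℤ × ℤ) (x : ℂ)
    (hγ : th τ (om N τ γ) ≠ 0) (hx : x ∉ latticeGamma τ) : ContinuousAt (phiG N τ γ) x := by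
  have hd := (th_differentiable τ hτ).continuous
  have hx' : th τ x ≠ 0 := fun h => hx ((th_lattice τ hτ _).mp h)
  have : phiG N τ γ = fun x => eN N ((γ.2 : ℂ) * x) * (th τ (om N τ γ + x) * deriv (th τ) 0 /
      (th τ (om N τ γ) * th τ x)) := by
    funext y; rw [phiG, kronPhi_eq τ hτ]
  rw [this]
  refine ContinuousAt.mul (by unfold eN; fun_prop) (ContinuousAt.div ?_ ?_ (mul_ne_zero hγ hx'))
  · exact Continuous.continuousAt (by fun_prop)
  · exact Continuous.continuousAt (by fun_prop)

theorem residue_zero (N : ℕ) (hN : 2 ≤ N) (τ : ℂ) (hτ : 0 < τ.im) (n : ℕ) (z : Fin n → ℂ)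
    (hz : ∀ a c : Fin n, a ≠ c → z a - z c ∉ latticeGamma τ) (γ : ℤ × ℤ)
    (hγ : redN N γ ≠ (0, 0)) (X : Fin n → ℂ)
    (h : ∀ w : ℂ, (∀ c : Fin n, w - z c ∉ latticeGamma τ) →
      ∑ c : Fin n, X c * phiG N τ γ (w - z c) = 0) (b : Fin n) : X b = 0 := by
  have hd := th_differentiable τ hτ
  have hω : th τ (om N τ γ) ≠ 0 := fun h =>
    om_not_mem N hN τ hτ γ hγ ((th_lattice τ hτ _).mp h)
  have hsub : Filter.Tendsto (fun w => w - z b) (nhdsWithin (z b) {z b}ᶜ) (nhdsWithin 0 {0}ᶜ) := by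
    refine tendsto_nhdsWithin_iff.mpr ⟨?_, ?_⟩
    · have : Continuous fun w => w - z b := by fun_prop
      have := this.tendsto (z b)
      rw [sub_self] at this
      exact this.mono_left nhdsWithin_le_nhds
    · filter_upwards [self_mem_nhdsWithin] with w hw
      simpa [sub_eq_zero] using hw
  have hadm : ∀ᶠ w in nhdsWithin (z b) {z b}ᶜ, ∀ c, w - z c ∉ latticeGamma τ := by
    rw [Filter.eventually_all]
    intro c
    by_cases hc : c = b
    · subst hc
      have h1 := (hd 0).hasDerivAt.eventually_ne (c := 0) (th_deriv_ne τ hτ)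
      filter_upwards [hsub.eventually h1] with w hw hmem
      exact hw ((th_lattice τ hτ _).mpr hmem)
    · have h1 : th τ (z b - z c) ≠ 0 := fun h' =>
        hz b c (Ne.symm hc) ((th_lattice τ hτ _).mp h')
      have h2 : Continuous fun w => th τ (w - z c) := by
        have := hd.continuous; fun_prop
      filter_upwards [nhdsWithin_le_nhds (h2.continuousAt.eventually_ne h1)] with w hw hmem
      exact hw ((th_lattice τ hτ _).mpr hmem)
  have hlim : Filter.Tendsto (fun w => ∑ c : Fin n, X c * ((w - z b) * phiG N τ γ (w - z c)))
      (nhdsWithin (z b) {z b}ᶜ) (nhds (∑ c : Fin n, X c * (if c = b then 1 else 0))) := by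
    refine tendsto_finsetSum _ fun c _ => Filter.Tendsto.const_mul _ ?_
    by_cases hc : c = b
    · subst hc
      simp only [if_true]
      exact (phiG_residue N hN τ hτ γ hγ).comp hsub
    · simp only [hc, if_false]
      have h1 := phiG_continuousAt N τ hτ γ (z b - z c) hω (hz b c (Ne.symm hc))
      have h2 : ContinuousAt (fun w => (w - z b) * phiG N τ γ (w - z c)) (z b) :=
        ContinuousAt.mul (by fun_prop)
          (ContinuousAt.comp (f := fun w => w - z c) (g := phiG N τ γ) h1 (by fun_prop))
      have h3 := h2.tendsto
      simp only [sub_self, zero_mul] at h3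
      exact h3.mono_left nhdsWithin_le_nhds
  have hzero : Filter.Tendsto (fun w => ∑ c : Fin n, X c * ((w - z b) * phiG N τ γ (w - z c)))
      (nhdsWithin (z b) {z b}ᶜ) (nhds 0) := by
    refine tendsto_const_nhds.congr' ?_
    filter_upwards [hadm] with w hw
    have := h w hw
    rw [← mul_zero (w - z b), ← this, Finset.mul_sum]
    refine Finset.sum_congr rfl fun c _ => by ring
  have := tendsto_nhds_unique hlim hzero
  simpa using this

/-! ### The matrices `T_γ` -/

/-- The primitive root of unity. -/
def zN (N : ℕ) : ℂ := eN N 1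

theorem eN_nat (N k : ℕ) : eN N (k : ℂ) = zN N ^ k := by
  rw [zN, eN, eN, ← Complex.exp_nat_mul]; congr 1; ring

theorem zN_prim (N : ℕ) (hN : 2 ≤ N) : IsPrimitiveRoot (zN N) N := by
  have := Complex.isPrimitiveRoot_exp N (by omega)
  rw [zN, eN, mul_one]; exact this

theorem Qm_pow (N k : ℕ) : Qm N ^ k = Matrix.diagonal fun i : Fin N => zN N ^ (((i : ℕ) + 1) * k) := by
  rw [Qm, Matrix.diagonal_pow]
  congr 1
  funext i
  have := eN_nat N ((i : ℕ) + 1)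
  push_cast at this
  rw [Pi.pow_apply, this, ← pow_mul]

theorem Lm_pow (N : ℕ) (k : ℕ) : Lm N ^ k =
    Matrix.of fun i j : Fin N => if ((i : ℕ) + k) % N = (j : ℕ) then (1 : ℂ) else 0 := by
  induction k with
  | zero =>
    ext i j
    simp only [pow_zero, Matrix.one_apply, Matrix.of_apply, add_zero, Nat.mod_eq_of_lt i.2, Fin.ext_iff]
  | succ k ih =>
    ext i j
    have hpos : 0 < N := i.pos
    rw [pow_succ, ih, Matrix.mul_apply]
    simp only [Matrix.of_apply, Lm]
    rw [Finset.sum_eq_single (⟨((i : ℕ) + k) % N, Nat.mod_lt _ hpos⟩ : Fin N)]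
    · simp only [if_true, one_mul]
      rw [Nat.mod_add_mod, add_assoc]
    · intro b _ hb
      rw [if_neg, zero_mul]
      intro h
      exact hb (Fin.ext h.symm)
    · intro h; exact absurd (Finset.mem_univ _) h

theorem Qm_pow_N (N : ℕ) (hN : 2 ≤ N) : Qm N ^ N = 1 := by
  rw [Qm_pow, ← Matrix.diagonal_one]
  congr 1
  funext i
  rw [mul_comm, pow_mul, (zN_prim N hN).pow_eq_one, one_pow]

theorem Lm_pow_N (N : ℕ) : Lm N ^ N = 1 := by
  rw [Lm_pow]
  ext i j
  simp [Matrix.one_apply, Nat.mod_eq_of_lt i.2, Fin.ext_iff]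

theorem Lm_Qm (N : ℕ) (hN : 2 ≤ N) (b c : ℕ) :
    Lm N ^ b * Qm N ^ c = zN N ^ (b * c) • (Qm N ^ c * Lm N ^ b) := by
  rw [Lm_pow, Qm_pow]
  ext i j
  rw [Matrix.smul_apply, Matrix.mul_diagonal, Matrix.diagonal_mul]
  simp only [Matrix.of_apply, smul_eq_mul]
  split_ifs with h
  · rw [mul_one, one_mul, ← pow_add, ← h]
    rw [← pow_mod_orderOf, ← (zN_prim N hN).eq_orderOf]
    conv_rhs => rw [← pow_mod_orderOf, ← (zN_prim N hN).eq_orderOf]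
    congr 1
    have : (((i : ℕ) + b) % N + 1) * c ≡ ((i : ℕ) + b + 1) * c [MOD N] :=
      ((Nat.mod_modEq _ _).add_right 1).mul_right c
    rw [show b * c + ((i : ℕ) + 1) * c = ((i : ℕ) + b + 1) * c by ring]
    exact this
  · simp

theorem trace_QL (N : ℕ) (hN : 2 ≤ N) (m k : ℕ) (h : ¬ (N ∣ m ∧ N ∣ k)) :
    Matrix.trace (Qm N ^ m * Lm N ^ k) = 0 := by
  rw [Qm_pow, Lm_pow, Matrix.trace]
  simp only [Matrix.diag_apply, Matrix.diagonal_mul, Matrix.of_apply]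
  by_cases hk : N ∣ k
  · have hm : ¬ N ∣ m := fun hm => h ⟨hm, hk⟩
    obtain ⟨r, rfl⟩ := hk
    have h1 : zN N ^ m ≠ 1 := fun h' => hm ((zN_prim N hN).dvd_of_pow_eq_one _ h')
    have h2 : (∑ i ∈ Finset.range N, (zN N ^ m) ^ i) = 0 := by
      have := mul_geom_sum (zN N ^ m) N
      rw [← pow_mul, mul_comm m N, pow_mul, (zN_prim N hN).pow_eq_one, one_pow, sub_self] at this
      exact (mul_eq_zero.mp this).resolve_left (sub_ne_zero.mpr h1)
    rw [← Fin.sum_univ_eq_sum_range] at h2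
    rw [← mul_zero (zN N ^ m), ← h2, Finset.mul_sum]
    refine Finset.sum_congr rfl fun i _ => ?_
    rw [Nat.add_mul_mod_self_left, Nat.mod_eq_of_lt i.2, if_pos rfl, mul_one, ← pow_succ', ← pow_mul,
      mul_comm]
  · refine Finset.sum_eq_zero fun i _ => ?_
    rw [if_neg, mul_zero]
    intro h'
    apply hk
    have h3 : (i : ℕ) + k ≡ (i : ℕ) + 0 [MOD N] := by
      rw [Nat.ModEq, h', add_zero, Nat.mod_eq_of_lt i.2]
    exact (Nat.modEq_zero_iff_dvd).mp (Nat.ModEq.add_left_cancel' _ h3)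

/-- The scalar prefactor of `T_γ`. -/
def sN (N : ℕ) (a b : ℕ) : ℂ := eN N ((((a : ℤ) * (b : ℤ) : ℤ) : ℂ) / 2)

theorem sN_ne (N a b : ℕ) : sN N a b ≠ 0 := Complex.exp_ne_zero _

theorem Tm_nat (N a b : ℕ) : Tm N ((a : ℤ), (b : ℤ)) = sN N a b • (Qm N ^ a * Lm N ^ b) := by
  simp only [Tm, sN, zpow_natCast]

theorem mem_Gamma (N : ℕ) (γ : ℤ × ℤ) : γ ∈ GammaN' N ↔
    (∃ a b : ℕ, a < N ∧ b < N ∧ γ = ((a : ℤ), (b : ℤ))) ∧ γ ≠ (0, 0) := by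
  simp only [GammaN', Finset.mem_sdiff, Finset.mem_image, Finset.mem_product, Finset.mem_range,
    Prod.exists, Finset.mem_singleton]
  refine and_congr_left fun _ => ⟨?_, ?_⟩
  · rintro ⟨a, b, ⟨ha, hb⟩, rfl⟩; exact ⟨a, b, ha, hb, rfl⟩
  · rintro ⟨a, b, ha, hb, rfl⟩; exact ⟨a, b, ⟨ha, hb⟩, rfl⟩

theorem red_of_mem (N : ℕ) (γ : ℤ × ℤ) (h : γ ∈ GammaN' N) : redN N γ ≠ (0, 0) := by
  obtain ⟨⟨a, b, ha, hb, rfl⟩, h0⟩ := (mem_Gamma N γ).mp h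
  rw [redN]
  simp only
  rw [Int.emod_eq_of_lt (by omega) (by omega), Int.emod_eq_of_lt (by omega) (by omega)]
  exact h0

theorem red_mem (N : ℕ) (hN : 2 ≤ N) (γ : ℤ × ℤ) (h : redN N γ ≠ (0, 0)) : redN N γ ∈ GammaN' N := by
  rw [mem_Gamma]
  refine ⟨⟨(γ.1 % N).toNat, (γ.2 % N).toNat, ?_, ?_, ?_⟩, h⟩
  · have := Int.emod_lt_of_pos γ.1 (by omega : (0 : ℤ) < N); omega
  · have := Int.emod_lt_of_pos γ.2 (by omega : (0 : ℤ) < N); omega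
  · rw [redN, Int.toNat_of_nonneg (Int.emod_nonneg _ (by omega)),
      Int.toNat_of_nonneg (Int.emod_nonneg _ (by omega))]

theorem Tm_indep (N : ℕ) (hN : 2 ≤ N) (c : ℤ × ℤ → ℂ)
    (h : ∑ γ ∈ GammaN' N, c γ • Tm N γ = 0) : ∀ γ ∈ GammaN' N, c γ = 0 := by
  intro γ₀ h₀
  obtain ⟨⟨a₀, b₀, ha₀, hb₀, rfl⟩, h0⟩ := (mem_Gamma N γ₀).mp h₀
  have key : ∀ a b : ℕ, Matrix.trace (Tm N ((a : ℤ), (b : ℤ)) *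
      (Lm N ^ (N - b₀) * Qm N ^ (N - a₀))) =
      sN N a b * Matrix.trace (Qm N ^ (N - a₀ + a) * Lm N ^ (b + (N - b₀))) := by
    intro a b
    rw [Tm_nat, Matrix.smul_mul, Matrix.trace_smul, smul_eq_mul]
    congr 1
    rw [← mul_assoc, Matrix.trace_mul_comm, mul_assoc (Qm N ^ a), ← pow_add, ← mul_assoc, ← pow_add]
  have h1 := congrArg (fun X => Matrix.trace (X * (Lm N ^ (N - b₀) * Qm N ^ (N - a₀)))) h
  simp only [Finset.sum_mul, Matrix.trace_sum, Matrix.smul_mul, Matrix.trace_smul, zero_mul,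
    Matrix.trace_zero] at h1
  rw [Finset.sum_eq_single ((a₀ : ℤ), (b₀ : ℤ))] at h1
  · rw [key, Nat.sub_add_cancel ha₀.le, Nat.add_sub_cancel' hb₀.le, Qm_pow_N N hN, Lm_pow_N, one_mul,
      Matrix.trace_one, Fintype.card_fin] at h1
    have hN0 : (N : ℂ) ≠ 0 := by exact_mod_cast (by omega : N ≠ 0)
    exact (smul_eq_zero.mp h1).resolve_right (mul_ne_zero (sN_ne _ _ _) hN0)
  · intro γ hγ hne
    obtain ⟨⟨a, b, ha, hb, rfl⟩, h0'⟩ := (mem_Gamma N γ).mp hγ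
    rw [key, trace_QL N hN, mul_zero, smul_zero]
    rintro ⟨⟨r, hr⟩, ⟨r', hr'⟩⟩
    apply hne
    have hr1 : r = 1 := by
      have h1 : 0 < r := by
        rcases Nat.eq_zero_or_pos r with h | h
        · subst h; omega
        · exact h
      have h2 : r < 2 := by
        by_contra h
        have : N * 2 ≤ N * r := Nat.mul_le_mul_left N (by omega)
        omega
      omega
    have hr2 : r' = 1 := by
      have h1 : 0 < r' := by
        rcases Nat.eq_zero_or_pos r' with h | h
        · subst h; omega
        · exact h
      have h2 : r' < 2 := by
        by_contra h
        have : N * 2 ≤ N * r' := Nat.mul_le_mul_left N (by omega)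
        omega
      omega
    subst hr1 hr2
    ext
    · simp only; omega
    · simp only; omega
  · intro h; exact absurd h₀ h

theorem Tm_comm_exists (N : ℕ) (hN : 2 ≤ N) (α β : ℤ × ℤ) (hα : α ∈ GammaN' N)
    (hβ : β ∈ GammaN' N) : ∃ k : ℂ, Tm N α * Tm N β - Tm N β * Tm N α = k • Tm N (redN N (α + β)) ∧
      (redN N (α + β) = (0, 0) → k = 0) := by
  obtain ⟨⟨a, b, ha, hb, rfl⟩, -⟩ := (mem_Gamma N α).mp hα
  obtain ⟨⟨c, d, hc, hd, rfl⟩, -⟩ := (mem_Gamma N β).mp hβ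
  have hprod : ∀ a b c d : ℕ, Tm N ((a : ℤ), (b : ℤ)) * Tm N ((c : ℤ), (d : ℤ)) =
      (sN N a b * sN N c d * zN N ^ (b * c)) • (Qm N ^ (a + c) * Lm N ^ (b + d)) := by
    intro a b c d
    rw [Tm_nat, Tm_nat, Matrix.smul_mul, Matrix.mul_smul, smul_smul]
    rw [show Qm N ^ a * Lm N ^ b * (Qm N ^ c * Lm N ^ d) =
      Qm N ^ a * (Lm N ^ b * Qm N ^ c) * Lm N ^ d by simp only [mul_assoc], Lm_Qm N hN,
      Matrix.mul_smul, Matrix.smul_mul, smul_smul, pow_add, pow_add]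
    simp only [mul_assoc]
  have hred : redN N (((a : ℤ), (b : ℤ)) + ((c : ℤ), (d : ℤ))) =
      ((((a + c) % N : ℕ) : ℤ), (((b + d) % N : ℕ) : ℤ)) := by
    simp [redN]
  have hT : Tm N (redN N (((a : ℤ), (b : ℤ)) + ((c : ℤ), (d : ℤ)))) =
      sN N ((a + c) % N) ((b + d) % N) • (Qm N ^ (a + c) * Lm N ^ (b + d)) := by
    rw [hred, Tm_nat, ← pow_eq_pow_mod (a + c) (Qm_pow_N N hN), ← pow_eq_pow_mod (b + d) (Lm_pow_N N)]
  refine ⟨sN N a b * sN N c d * (zN N ^ (b * c) - zN N ^ (d * a)) /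
    sN N ((a + c) % N) ((b + d) % N), ?_, ?_⟩
  · rw [hT, hprod, hprod, smul_smul, div_mul_cancel₀ _ (sN_ne _ _ _), add_comm c a, add_comm d b,
      ← sub_smul]
    congr 1
    ring
  · intro h
    rw [hred, Prod.mk.injEq] at h
    have h1 : (a + c) % N = 0 := by exact_mod_cast h.1
    have h2 : (b + d) % N = 0 := by exact_mod_cast h.2
    obtain ⟨u, hu⟩ := Nat.dvd_of_mod_eq_zero h1
    obtain ⟨v, hv⟩ := Nat.dvd_of_mod_eq_zero h2
    have hm : zN N ^ (b * c) = zN N ^ (d * a) := by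
      have e : b * c + N * (u * d) = d * a + N * (v * c) := by
        have e1 : (a + c) * d = N * u * d := by rw [hu]
        have e2 : (b + d) * c = N * v * c := by rw [hv]
        nlinarith
      have := congrArg (fun k => zN N ^ k) e
      simpa [pow_add, pow_mul, (zN_prim N hN).pow_eq_one] using this
    rw [hm, sub_self, mul_zero, zero_div]

/-- Structure constants. -/
def kN (N : ℕ) (α β : ℤ × ℤ) : ℂ := Classical.epsilon fun k : ℂ =>
  Tm N α * Tm N β - Tm N β * Tm N α = k • Tm N (redN N (α + β)) ∧
      (redN N (α + β) = (0, 0) → k = 0)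

theorem kN_spec (N : ℕ) (hN : 2 ≤ N) (α β : ℤ × ℤ) (hα : α ∈ GammaN' N)
    (hβ : β ∈ GammaN' N) :
    Tm N α * Tm N β - Tm N β * Tm N α = kN N α β • Tm N (redN N (α + β)) ∧
      (redN N (α + β) = (0, 0) → kN N α β = 0) :=
  Classical.epsilon_spec (Tm_comm_exists N hN α β hα hβ)

/-! ### Brackets in coordinates -/

/-- Coordinates of the commutator. -/
def brN (N : ℕ) (X Y : ℤ × ℤ → ℂ) (γ : ℤ × ℤ) : ℂ :=
  ∑ α ∈ GammaN' N, ∑ β ∈ GammaN' N,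
    if redN N (α + β) = γ then X α * Y β * kN N α β else 0

/-- The matrix with given coordinates. -/
def matN (N : ℕ) (X : ℤ × ℤ → ℂ) : Matrix (Fin N) (Fin N) ℂ := ∑ γ ∈ GammaN' N, X γ • Tm N γ

theorem matN_comm (N : ℕ) (hN : 2 ≤ N) (X Y : ℤ × ℤ → ℂ) :
    matN N X * matN N Y - matN N Y * matN N X = matN N (brN N X Y) := by
  have h1 : matN N X * matN N Y = ∑ α ∈ GammaN' N, ∑ β ∈ GammaN' N,
      (X α * Y β) • (Tm N α * Tm N β) := by
    simp only [matN, Finset.sum_mul, Finset.mul_sum, Matrix.smul_mul, Matrix.mul_smul, smul_smul]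
    rw [Finset.sum_comm]
    refine Finset.sum_congr rfl fun α _ => Finset.sum_congr rfl fun β _ => ?_
    first | rfl | rw [mul_comm]
  have h2 : matN N Y * matN N X = ∑ α ∈ GammaN' N, ∑ β ∈ GammaN' N,
      (X α * Y β) • (Tm N β * Tm N α) := by
    simp only [matN, Finset.sum_mul, Finset.mul_sum, Matrix.smul_mul, Matrix.mul_smul, smul_smul]
  have h3 : matN N (brN N X Y) = ∑ α ∈ GammaN' N, ∑ β ∈ GammaN' N,
      (X α * Y β) • (kN N α β • Tm N (redN N (α + β))) := by
    simp only [matN, brN, Finset.sum_smul]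
    rw [Finset.sum_comm]
    refine Finset.sum_congr rfl fun α hα => ?_
    rw [Finset.sum_comm]
    refine Finset.sum_congr rfl fun β hβ => ?_
    simp only [ite_smul, zero_smul, Finset.sum_ite_eq]
    split_ifs with h
    · rw [smul_smul]
    · have h0 : redN N (α + β) = (0, 0) := by
        by_contra hne
        exact h (red_mem N hN _ hne)
      rw [(kN_spec N hN α β hα hβ).2 h0, zero_smul, smul_zero]
  rw [h1, h2, h3, ← Finset.sum_sub_distrib]
  refine Finset.sum_congr rfl fun α hα => ?_
  rw [← Finset.sum_sub_distrib]
  refine Finset.sum_congr rfl fun β hβ => ?_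
  rw [← smul_sub, (kN_spec N hN α β hα hβ).1]

theorem matN_inj (N : ℕ) (hN : 2 ≤ N) (X Y : ℤ × ℤ → ℂ) :
    matN N X = matN N Y ↔ ∀ γ ∈ GammaN' N, X γ = Y γ := by
  constructor
  · intro h γ hγ
    refine sub_eq_zero.mp (Tm_indep N hN (fun γ => X γ - Y γ) ?_ γ hγ)
    simp only [sub_smul, Finset.sum_sub_distrib]
    exact sub_eq_zero.mpr h
  · intro h
    exact Finset.sum_congr rfl fun γ hγ => by rw [h γ hγ]

theorem matN_sum {ι : Type*} (N : ℕ) (s : Finset ι) (X : ι → ℤ × ℤ → ℂ) :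
    ∑ c ∈ s, matN N (X c) = matN N fun γ => ∑ c ∈ s, X c γ := by
  simp only [matN, Finset.sum_smul]
  rw [Finset.sum_comm]

theorem matN_neg (N : ℕ) (X : ℤ × ℤ → ℂ) : - matN N X = matN N fun γ => - X γ := by
  simp only [matN, neg_smul, Finset.sum_neg_distrib]

theorem brN_anti (N : ℕ) (hN : 2 ≤ N) (X Y : ℤ × ℤ → ℂ) (γ : ℤ × ℤ) (hγ : γ ∈ GammaN' N) :
    brN N X Y γ = - brN N Y X γ := by
  refine (matN_inj N hN _ (fun γ => - brN N Y X γ)).mp ?_ γ hγ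
  rw [← matN_neg, ← matN_comm N hN, ← matN_comm N hN, neg_sub]

theorem brN_fay (N : ℕ) (hN : 2 ≤ N) (τ : ℂ) (hτ : 0 < τ.im) (X Y : ℤ × ℤ → ℂ) (x y : ℂ)
    (hx : x ∉ latticeGamma τ) (hy : y ∉ latticeGamma τ) (hxy : x - y ∉ latticeGamma τ)
    (γ : ℤ × ℤ) (hγ : γ ∈ GammaN' N) :
    brN N (fun α => X α * phiG N τ α x) (fun β => Y β * phiG N τ β y) γ =
      brN N (fun α => X α * phiG N τ α (x - y)) Y γ * phiG N τ γ y +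
      brN N X (fun β => Y β * phiG N τ β (y - x)) γ * phiG N τ γ x := by
  simp only [brN, Finset.sum_mul, ← Finset.sum_add_distrib]
  refine Finset.sum_congr rfl fun α hα => Finset.sum_congr rfl fun β hβ => ?_
  split_ifs with h
  · have h0 := mem_Gamma N γ |>.mp hγ |>.2
    have := phiG_fay N hN τ hτ α β x y (red_of_mem N α hα) (red_of_mem N β hβ) (h ▸ h0) hx hy hxy
    rw [h] at this
    linear_combination X α * Y β * kN N α β * this
  · simp

/-- Coordinates of the right-hand side of the equations of motion. -/
def rhsN (N : ℕ) (τ : ℂ) {n : ℕ} (z : Fin n → ℂ) (a : Fin n) (S : Fin n → ℤ × ℤ → ℂ)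
    (c : Fin n) (γ : ℤ × ℤ) : ℂ :=
  if c = a then -∑ b ∈ Finset.univ.filter (fun b => b ≠ a),
      brN N (S a) (fun α => S b α * phiG N τ α (z a - z b)) γ
  else brN N (S c) (fun α => S a α * phiG N τ α (z c - z a)) γ

theorem lax_rhs (N : ℕ) (hN : 2 ≤ N) (τ : ℂ) (hτ : 0 < τ.im) {n : ℕ} (z : Fin n → ℂ)
    (hz : ∀ a c : Fin n, a ≠ c → z a - z c ∉ latticeGamma τ) (a : Fin n)
    (S : Fin n → ℤ × ℤ → ℂ) (w : ℂ) (hw : ∀ c : Fin n, w - z c ∉ latticeGamma τ) :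
    (∑ c, matN N fun γ => S c γ * phiG N τ γ (w - z c)) *
        matN N (fun γ => S a γ * phiG N τ γ (w - z a)) -
      matN N (fun γ => S a γ * phiG N τ γ (w - z a)) *
        (∑ c, matN N fun γ => S c γ * phiG N τ γ (w - z c)) =
    matN N fun γ => ∑ c, rhsN N τ z a S c γ * phiG N τ γ (w - z c) := by
  rw [Finset.sum_mul, Finset.mul_sum, ← Finset.sum_sub_distrib,
    ← Finset.sum_filter_add_sum_filter_not Finset.univ (fun c => c ≠ a)]
  have h0 : (Finset.univ.filter fun c : Fin n => ¬ c ≠ a) = {a} := by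
    ext c; simp
  rw [h0, Finset.sum_singleton, sub_self, add_zero]
  simp only [matN_comm N hN]
  rw [matN_sum, matN_inj N hN]
  intro γ hγ
  rw [← Finset.sum_filter_add_sum_filter_not Finset.univ (fun c => c ≠ a)
    (fun c => rhsN N τ z a S c γ * phiG N τ γ (w - z c)), h0, Finset.sum_singleton]
  rw [show rhsN N τ z a S a γ = ∑ b ∈ Finset.univ.filter (fun b => b ≠ a),
      brN N (fun α => S b α * phiG N τ α (z a - z b)) (S a) γ by
    rw [rhsN, if_pos rfl, ← Finset.sum_neg_distrib]
    refine Finset.sum_congr rfl fun b _ => ?_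
    rw [brN_anti N hN _ _ γ hγ, neg_neg], Finset.sum_mul, ← Finset.sum_add_distrib]
  refine Finset.sum_congr rfl fun c hc => ?_
  have hca : c ≠ a := (Finset.mem_filter.mp hc).2
  have e1 : w - z c - (w - z a) = z a - z c := by ring
  have e2 : w - z a - (w - z c) = z c - z a := by ring
  have h := brN_fay N hN τ hτ (S c) (S a) (w - z c) (w - z a) (hw c) (hw a)
    (by rw [e1]; exact hz a c hca.symm) γ hγ
  rw [e1, e2] at h
  rw [h, rhsN, if_neg hca, add_comm]


/-- **Proposition 2.1, part 1** (first flows of the elliptic sl(N) Gaudin model):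
the equations of motion hold iff the Lax equation `∂_t L = [L, M_a]` holds. -/
theorem elliptic_gaudin_first_flow_lax
    (τ : ℂ) (hτ : 0 < τ.im) (N : ℕ) (hN : 2 ≤ N)
    (n : ℕ) (z : Fin n → ℂ)
    (hz : ∀ a c : Fin n, a ≠ c → z a - z c ∉ latticeGamma τ)
    (a : Fin n)
    (S : Fin n → (ℤ × ℤ) → ℝ → ℂ)
    (hS : ∀ c γ, Differentiable ℝ (S c γ)) :
    ((∀ t : ℝ,
        (∑ γ ∈ GammaN' N, deriv (S a γ) t • Tm N γ)
          = -(∑ c ∈ Finset.univ.filter (fun c => c ≠ a),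
              (Smat N S a t * phiHatS N τ S (z a - z c) c t
                - phiHatS N τ S (z a - z c) c t * Smat N S a t)))
      ∧ (∀ t : ℝ, ∀ b : Fin n, b ≠ a →
          (∑ γ ∈ GammaN' N, deriv (S b γ) t • Tm N γ)
            = Smat N S b t * phiHatS N τ S (z b - z a) a t
                - phiHatS N τ S (z b - z a) a t * Smat N S b t))
    ↔ (∀ t : ℝ, ∀ w : ℂ, (∀ c : Fin n, w - z c ∉ latticeGamma τ) →
        (∑ c : Fin n, ∑ γ ∈ GammaN' N,
            (deriv (S c γ) t * phiG N τ γ (w - z c)) • Tm N γ)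
          = (∑ c : Fin n, ∑ γ ∈ GammaN' N, (S c γ t * phiG N τ γ (w - z c)) • Tm N γ)
                * phiHatS N τ S (w - z a) a t
              - phiHatS N τ S (w - z a) a t
                * (∑ c : Fin n, ∑ γ ∈ GammaN' N,
                    (S c γ t * phiG N τ γ (w - z c)) • Tm N γ)) := by
  have hSm : ∀ c t, Smat N S c t = matN N fun γ => S c γ t := fun c t => rfl
  have hPh : ∀ x c t, phiHatS N τ S x c t = matN N fun γ => S c γ t * phiG N τ γ x :=
    fun x c t => rfl
  have hEOM : ((∀ t : ℝ,
        (∑ γ ∈ GammaN' N, deriv (S a γ) t • Tm N γ)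
          = -(∑ c ∈ Finset.univ.filter (fun c => c ≠ a),
              (Smat N S a t * phiHatS N τ S (z a - z c) c t
                - phiHatS N τ S (z a - z c) c t * Smat N S a t)))
      ∧ (∀ t : ℝ, ∀ b : Fin n, b ≠ a →
          (∑ γ ∈ GammaN' N, deriv (S b γ) t • Tm N γ)
            = Smat N S b t * phiHatS N τ S (z b - z a) a t
                - phiHatS N τ S (z b - z a) a t * Smat N S b t)) ↔
      ∀ t : ℝ, ∀ c : Fin n, ∀ γ ∈ GammaN' N,
        deriv (S c γ) t = rhsN N τ z a (fun c γ => S c γ t) c γ := by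
    have hA : ∀ t : ℝ, ((∑ γ ∈ GammaN' N, deriv (S a γ) t • Tm N γ)
          = -(∑ c ∈ Finset.univ.filter (fun c => c ≠ a),
              (Smat N S a t * phiHatS N τ S (z a - z c) c t
                - phiHatS N τ S (z a - z c) c t * Smat N S a t))) ↔
        ∀ γ ∈ GammaN' N, deriv (S a γ) t = rhsN N τ z a (fun c γ => S c γ t) a γ := by
      intro t
      simp only [hSm, hPh, matN_comm N hN]
      rw [matN_sum, matN_neg]
      refine (matN_inj N hN (fun γ => deriv (S a γ) t) _).trans ?_
      simp only [rhsN, if_true]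
    have hB : ∀ t : ℝ, ∀ b : Fin n, b ≠ a → ((∑ γ ∈ GammaN' N, deriv (S b γ) t • Tm N γ)
            = Smat N S b t * phiHatS N τ S (z b - z a) a t
                - phiHatS N τ S (z b - z a) a t * Smat N S b t ↔
        ∀ γ ∈ GammaN' N, deriv (S b γ) t = rhsN N τ z a (fun c γ => S c γ t) b γ) := by
      intro t b hb
      simp only [hSm, hPh, matN_comm N hN]
      refine (matN_inj N hN (fun γ => deriv (S b γ) t) _).trans ?_
      simp only [rhsN, hb, if_false]
    constructor
    · rintro ⟨h1, h2⟩ t c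
      by_cases hc : c = a
      · subst hc; exact (hA t).mp (h1 t)
      · exact (hB t c hc).mp (h2 t c hc)
    · intro h
      exact ⟨fun t => (hA t).mpr (h t a), fun t b hb => (hB t b hb).mpr (h t b)⟩
  rw [hEOM]
  have hLax : ∀ (t : ℝ) (w : ℂ), (∀ c : Fin n, w - z c ∉ latticeGamma τ) →
      (((∑ c : Fin n, ∑ γ ∈ GammaN' N,
            (deriv (S c γ) t * phiG N τ γ (w - z c)) • Tm N γ)
          = (∑ c : Fin n, ∑ γ ∈ GammaN' N, (S c γ t * phiG N τ γ (w - z c)) • Tm N γ)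
                * phiHatS N τ S (w - z a) a t
              - phiHatS N τ S (w - z a) a t
                * (∑ c : Fin n, ∑ γ ∈ GammaN' N,
                    (S c γ t * phiG N τ γ (w - z c)) • Tm N γ)) ↔
      ∀ γ ∈ GammaN' N, ∑ c : Fin n, deriv (S c γ) t * phiG N τ γ (w - z c) =
        ∑ c : Fin n, rhsN N τ z a (fun c γ => S c γ t) c γ * phiG N τ γ (w - z c)) := by
    intro t w hw
    have h1 := lax_rhs N hN τ hτ z hz a (fun c γ => S c γ t) w hw
    have h2 := matN_sum N Finset.univ
      (fun (c : Fin n) γ => deriv (S c γ) t * phiG N τ γ (w - z c))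
    simp only [matN] at h1 h2
    simp only [phiHatS]
    rw [h1, h2]
    exact matN_inj N hN (fun γ => ∑ c : Fin n, deriv (S c γ) t * phiG N τ γ (w - z c))
      (fun γ => ∑ c : Fin n, rhsN N τ z a (fun c γ => S c γ t) c γ * phiG N τ γ (w - z c))
  constructor
  · intro h t w hw
    rw [hLax t w hw]
    intro γ hγ
    exact Finset.sum_congr rfl fun c _ => by rw [h t c γ hγ]
  · intro h t c γ hγ
    refine sub_eq_zero.mp (residue_zero N hN τ hτ n z hz γ (red_of_mem N γ hγ)
      (fun c => deriv (S c γ) t - rhsN N τ z a (fun c γ => S c γ t) c γ) ?_ c)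
    intro w hw
    have := (hLax t w hw).mp (h t w hw) γ hγ
    simp only [sub_mul, Finset.sum_sub_distrib]
    exact sub_eq_zero.mpr this

end
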